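/- arXiv:2001.01141 — 11 statements merged into one kernel-verified Lean document; each statement's English description precedes it below -/
import Mathlib

section
/- Let p ≥ k ≥ 1, let U ∈ ℂ^{p×k} satisfy U^H U = I_k, let Σ be a k×k Hermitian positive definite complex matrix, and let α, β be real numbers with α > 0 and β > −α/k. Then for every pair ξ = (ξ_U, ξ_Σ) with ξ_U ∈ ℂ^{p×k} arbitrary and ξ_Σ ∈ ℂ^{k×k} Hermitian, the quantity ⟨ξ,ξ⟩_{(U,Σ)} = Re tr(ξ_U^H (I_p − (1/2) U U^H) ξ_U) + α · Re tr(Σ^{-1} ξ_Σ Σ^{-1} ξ_Σ) + β · (Re tr(Σ^{-1} ξ_Σ))^2 is nonnegative, and it equals zero if and only if ξ_U = 0 and ξ_Σ = 0. In other words, the proposed Riemannian metric is positive definite. -/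
open Matrix
open scoped ComplexOrder

lemma aux_nonneg {m n : ℕ} (A : Matrix (Fin m) (Fin n) ℂ) : 0 ≤ (Matrix.trace (Aᴴ * A)).re := by
  have := (posSemidef_conjTranspose_mul_self A).trace_nonneg
  exact (Complex.le_def.1 this).1

lemma aux_zero {m n : ℕ} (A : Matrix (Fin m) (Fin n) ℂ) (h : (Matrix.trace (Aᴴ * A)).re = 0) :
    A = 0 := by
  have h1 := (posSemidef_conjTranspose_mul_self A).trace_nonneg
  refine trace_conjTranspose_mul_self_eq_zero_iff.1 ?_
  exact Complex.ext h (Complex.le_def.1 h1).2.symm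

lemma aux_U {p k : ℕ} (U : Matrix (Fin p) (Fin k) ℂ) (hU : Uᴴ * U = 1)
    (X : Matrix (Fin p) (Fin k) ℂ) :
    (Matrix.trace (Xᴴ * ((1 : Matrix (Fin p) (Fin p) ℂ) - (1/2 : ℂ) • (U * Uᴴ)) * X)).re
      = 1/2 * (Matrix.trace (((1 - U * Uᴴ) * X)ᴴ * ((1 - U * Uᴴ) * X))).re
        + 1/2 * (Matrix.trace (Xᴴ * X)).re := by
  have hP : (1 - U * Uᴴ)ᴴ * (1 - U * Uᴴ) = 1 - U * Uᴴ := by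
    have : U * Uᴴ * (U * Uᴴ) = U * Uᴴ := by
      rw [Matrix.mul_assoc, ← Matrix.mul_assoc Uᴴ, hU, Matrix.one_mul]
    simp [Matrix.mul_sub, Matrix.sub_mul, this]
  have h1 : ((1 - U * Uᴴ) * X)ᴴ * ((1 - U * Uᴴ) * X) = Xᴴ * (1 - U * Uᴴ) * X := by
    rw [conjTranspose_mul, Matrix.mul_assoc, ← Matrix.mul_assoc _ _ X, hP, Matrix.mul_assoc]
  rw [h1]
  simp only [Matrix.mul_sub, Matrix.sub_mul, Matrix.mul_one, Matrix.mul_smul, Matrix.smul_mul,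
    trace_sub, trace_smul, Complex.sub_re, smul_eq_mul]
  have : ((1/2 : ℂ) * (Xᴴ * (U * Uᴴ) * X).trace).re = 1/2 * ((Xᴴ * (U * Uᴴ) * X).trace).re := by
    simp [Complex.mul_re]
  rw [this]; ring

lemma aux_CS {k : ℕ} (hk : 1 ≤ k) (M : Matrix (Fin k) (Fin k) ℂ) (hM : M.IsHermitian) :
    (M.trace.re) ^ 2 / k ≤ (Matrix.trace (M * M)).re := by
  set c : ℝ := M.trace.re / k with hc
  have hk' : (k : ℝ) ≠ 0 := by positivity
  have h := aux_nonneg (M - (c : ℂ) • (1 : Matrix (Fin k) (Fin k) ℂ))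
  have hE : (M - (c : ℂ) • (1 : Matrix (Fin k) (Fin k) ℂ))ᴴ = M - (c : ℂ) • 1 := by
    simp [conjTranspose_sub, conjTranspose_smul, hM.eq]
  rw [hE] at h
  simp [Matrix.mul_sub, Matrix.sub_mul, trace_sub, trace_smul, Complex.mul_re] at h
  have : M.trace.re = c * k := by rw [hc]; field_simp
  rw [this] at h ⊢
  have h2 : (c * k) ^ 2 / k = c * (c * k) := by field_simp
  rw [h2]; linarith

theorem metric_posDef (p k : ℕ) (hk : 1 ≤ k) (hpk : k ≤ p)
    (U : Matrix (Fin p) (Fin k) ℂ) (hU : Uᴴ * U = 1)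
    (Sig : Matrix (Fin k) (Fin k) ℂ) (hSig : Sig.PosDef)
    (α β : ℝ) (hα : 0 < α) (hβ : -(α / k) < β) :
    ∀ (ξU : Matrix (Fin p) (Fin k) ℂ) (ξS : Matrix (Fin k) (Fin k) ℂ), ξS.IsHermitian →
      0 ≤ (Matrix.trace (ξUᴴ * ((1 : Matrix (Fin p) (Fin p) ℂ) - (1/2 : ℂ) • (U * Uᴴ)) * ξU)).re
          + α * (Matrix.trace (Sig⁻¹ * ξS * Sig⁻¹ * ξS)).re
          + β * ((Matrix.trace (Sig⁻¹ * ξS)).re) ^ 2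
      ∧ ((Matrix.trace (ξUᴴ * ((1 : Matrix (Fin p) (Fin p) ℂ) - (1/2 : ℂ) • (U * Uᴴ)) * ξU)).re
          + α * (Matrix.trace (Sig⁻¹ * ξS * Sig⁻¹ * ξS)).re
          + β * ((Matrix.trace (Sig⁻¹ * ξS)).re) ^ 2 = 0
        ↔ ξU = 0 ∧ ξS = 0) := by
  intro X S hS
  obtain ⟨B, hBu, hB⟩ : ∃ B : Matrix (Fin k) (Fin k) ℂ, IsUnit B ∧ Sig⁻¹ = Bᴴ * B := by
    open scoped MatrixOrder in
    obtain ⟨B, hB⟩ := CStarAlgebra.nonneg_iff_eq_star_mul_self.1 hSig.inv.posSemidef.nonneg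
    refine ⟨B, ?_, hB⟩
    have := hSig.inv.isUnit
    rw [hB] at this
    exact isUnit_of_mul_isUnit_right this
  set M := B * S * Bᴴ with hMdef
  have hM : M.IsHermitian := by
    simp [Matrix.IsHermitian, hMdef, conjTranspose_mul, hS.eq, Matrix.mul_assoc]
  have h1 : (Sig⁻¹ * S).trace = M.trace := by
    rw [hB, hMdef, Matrix.mul_assoc, trace_mul_comm]
  have h2 : (Sig⁻¹ * S * Sig⁻¹ * S).trace = (M * M).trace := by
    rw [hB, hMdef, show Bᴴ * B * S * (Bᴴ * B) * S = Bᴴ * (B * S * Bᴴ * B * S) by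
      simp only [Matrix.mul_assoc], trace_mul_comm]
    simp only [Matrix.mul_assoc]
  have hCS := aux_CS hk M hM
  have hX := aux_nonneg X
  have hPX := aux_nonneg ((1 - U * Uᴴ) * X)
  have hMM := aux_nonneg M
  have hMz := aux_zero M
  rw [hM.eq] at hMM hMz
  rw [h1, h2, aux_U U hU X]
  have hk' : (0:ℝ) < k := by positivity
  generalize hb : (M * M).trace.re = b at *
  generalize ht : M.trace.re = t at *
  have key : α * b + β * t ^ 2 = α * (b - t ^ 2 / k) + (β + α / k) * t ^ 2 := by
    field_simp; ring
  have k1 : 0 ≤ α * (b - t ^ 2 / k) := mul_nonneg hα.le (by linarith)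
  have hc : 0 < β + α / k := by linarith
  have k2 : 0 ≤ (β + α / k) * t ^ 2 := by positivity
  refine ⟨by linarith, fun h => ?_, ?_⟩
  · refine ⟨aux_zero X (by linarith), ?_⟩
    have e1 : α * (b - t ^ 2 / k) = 0 := by linarith
    have e2 : (β + α / k) * t ^ 2 = 0 := by linarith
    have e3 : t ^ 2 = 0 := (mul_eq_zero.1 e2).resolve_left hc.ne'
    have e4 := (mul_eq_zero.1 e1).resolve_left hα.ne'
    rw [e3] at e4
    have hM0 : B * S * Bᴴ = 0 := hMz (by simpa using e4)
    have hBs : IsUnit Bᴴ := hBu.star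
    exact (hBu.mul_right_eq_zero).1 ((hBs.mul_left_eq_zero).1 hM0)
  · rintro ⟨rfl, rfl⟩
    have hM0 : M = 0 := by simp [hMdef]
    rw [hM0] at hb ht
    simp at hb ht
    simp [← hb, ← ht]
end

section
/- Let p ≥ k ≥ 1, let U ∈ ℂ^{p×k} satisfy U^H U = I_k, let Σ be a k×k Hermitian positive definite complex matrix, let α, β be real numbers, and let O ∈ ℂ^{k×k} be unitary (O^H O = I_k). Then for all ξ_U, η_U ∈ ℂ^{p×k} and all Hermitian ξ_Σ, η_Σ ∈ ℂ^{k×k}: Re tr(ξ_U^H (I_p − (1/2) U U^H) η_U) + α Re tr(Σ^{-1} ξ_Σ Σ^{-1} η_Σ) + β Re tr(Σ^{-1} ξ_Σ) · Re tr(Σ^{-1} η_Σ) = Re tr((ξ_U O)^H (I_p − (1/2)(UO)(UO)^H)(η_U O)) + α Re tr((O^H Σ O)^{-1} (O^H ξ_Σ O)(O^H Σ O)^{-1} (O^H η_Σ O)) + β Re tr((O^H Σ O)^{-1}(O^H ξ_Σ O)) · Re tr((O^H Σ O)^{-1}(O^H η_Σ O)). That is, the metric is invariant under the simultaneous action θ̄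 ↦ (UO, O^H Σ O), ξ ↦ (ξ_U O, O^H ξ_Σ O) of the unitary group U_k. -/
open Matrix
open scoped ComplexOrder

/-- The proposed Riemannian metric on `St_{p,k} × H^{++}_k` is invariant
under the simultaneous action `(U,Σ) ↦ (UO, OᴴΣO)`, `(ξU,ξΣ) ↦ (ξU O, Oᴴ ξΣ O)` of the
unitary group `U_k`.  Here `Sig` plays the role of `Σ`. -/
theorem metric_unitary_invariance (p k : ℕ) (hk : 1 ≤ k) (hpk : k ≤ p)
    (U : Matrix (Fin p) (Fin k) ℂ) (hU : Uᴴ * U = 1)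
    (Sig : Matrix (Fin k) (Fin k) ℂ) (hSig : Sig.PosDef)
    (α β : ℝ)
    (O : Matrix (Fin k) (Fin k) ℂ) (hO : Oᴴ * O = 1) :
    ∀ (ξU ηU : Matrix (Fin p) (Fin k) ℂ) (ξS ηS : Matrix (Fin k) (Fin k) ℂ),
      ξS.IsHermitian → ηS.IsHermitian →
      (Matrix.trace (ξUᴴ * ((1 : Matrix (Fin p) (Fin p) ℂ) - (1/2 : ℂ) • (U * Uᴴ)) * ηU)).re
        + α * (Matrix.trace (Sig⁻¹ * ξS * Sig⁻¹ * ηS)).re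
        + β * ((Matrix.trace (Sig⁻¹ * ξS)).re * (Matrix.trace (Sig⁻¹ * ηS)).re)
      = (Matrix.trace ((ξU * O)ᴴ *
            ((1 : Matrix (Fin p) (Fin p) ℂ) - (1/2 : ℂ) • ((U * O) * (U * O)ᴴ)) * (ηU * O))).re
        + α * (Matrix.trace ((Oᴴ * Sig * O)⁻¹ * (Oᴴ * ξS * O) * (Oᴴ * Sig * O)⁻¹
            * (Oᴴ * ηS * O))).re
        + β * ((Matrix.trace ((Oᴴ * Sig * O)⁻¹ * (Oᴴ * ξS * O))).re
            * (Matrix.trace ((Oᴴ * Sig * O)⁻¹ * (Oᴴ * ηS * O))).re) := by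
  intro ξU ηU ξS ηS _ _
  have hO' : O * Oᴴ = 1 := mul_eq_one_comm.mp hO
  have e1 : O⁻¹ = Oᴴ := Matrix.inv_eq_left_inv hO
  have e2 : Oᴴ⁻¹ = O := Matrix.inv_eq_left_inv hO'
  have hinv : (Oᴴ * Sig * O)⁻¹ = Oᴴ * Sig⁻¹ * O := by
    rw [Matrix.mul_inv_rev, Matrix.mul_inv_rev, e1, e2, Matrix.mul_assoc]
  have hm : ∀ A B : Matrix (Fin k) (Fin k) ℂ,
      (Oᴴ * A * O) * (Oᴴ * B * O) = Oᴴ * (A * B) * O := by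
    intro A B
    calc (Oᴴ * A * O) * (Oᴴ * B * O) = Oᴴ * A * (O * Oᴴ) * B * O := by
          simp only [Matrix.mul_assoc]
      _ = _ := by rw [hO']; simp only [Matrix.mul_assoc, Matrix.mul_one]
  have ht : ∀ A : Matrix (Fin k) (Fin k) ℂ, (Oᴴ * A * O).trace = A.trace := by
    intro A
    rw [Matrix.trace_mul_comm, ← Matrix.mul_assoc, hO', Matrix.one_mul]
  have hUU : (U * O) * (U * O)ᴴ = U * Uᴴ := by
    rw [Matrix.conjTranspose_mul, Matrix.mul_assoc, ← Matrix.mul_assoc O, hO', Matrix.one_mul]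
  have h1 : ∀ M : Matrix (Fin p) (Fin p) ℂ,
      (ξU * O)ᴴ * M * (ηU * O) = Oᴴ * (ξUᴴ * M * ηU) * O := by
    intro M
    simp only [Matrix.conjTranspose_mul, Matrix.mul_assoc]
  rw [hUU, h1, hinv, hm, hm, hm, hm, ht, ht, ht, ht]
end

section
/- Let p ≥ k ≥ 1, let U ∈ ℂ^{p×k} satisfy U^H U = I_k, let Σ be a k×k Hermitian positive definite complex matrix, and let α > 0, β be real. For arbitrary Z_U ∈ ℂ^{p×k} and Z_Σ ∈ ℂ^{k×k}, define P(Z) = (Z_U − U·herm(U^H Z_U), herm(Z_Σ)). Then: (i) P(Z) lies in the tangent space, i.e. U^H (Z_U − U·herm(U^H Z_U)) is skew-Hermitian and herm(Z_Σ) is Hermitian; (ii) the residual Z − P(Z) = (U·herm(U^H Z_U), skewh(Z_Σ)) is orthogonal to every tangent vector with respect to the metric: for every ξ_U ∈ ℂ^{p×k} with U^H ξ_U skew-Hermitian and every Hermitian ξ_Σ ∈ ℂ^{k×k}, one has Re tr((U·herm(U^H Z_U))^H (I_p − (1/2) U U^H) ξ_U) + α Re tr(Σ^{-1} skewh(Z_Σ)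 Σ^{-1} ξ_Σ) + β Re(tr(Σ^{-1} skewh(Z_Σ)) · tr(Σ^{-1} ξ_Σ)) = 0. -/
open Matrix
open scoped ComplexOrder

/-- The Hermitian part of a square complex matrix. -/
noncomputable def hermPart {m : Type*} [Fintype m] (A : Matrix m m ℂ) : Matrix m m ℂ :=
  (1/2 : ℂ) • (A + Aᴴ)

/-- The skew-Hermitian part of a square complex matrix. -/
noncomputable def skewhPart {m : Type*} [Fintype m] (A : Matrix m m ℂ) : Matrix m m ℂ :=
  (1/2 : ℂ) • (A - Aᴴ)

theorem hermPart_conj {m : Type*} [Fintype m] (A : Matrix m m ℂ) : (hermPart A)ᴴ = hermPart A := by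
  simp [hermPart, conjTranspose_smul, add_comm]

theorem skewhPart_conj {m : Type*} [Fintype m] (A : Matrix m m ℂ) :
    (skewhPart A)ᴴ = -skewhPart A := by
  simp [skewhPart, conjTranspose_smul, ← smul_neg]

theorem trace_re_zero {m : Type*} [Fintype m] (A B : Matrix m m ℂ) (hA : Aᴴ = A) (hB : Bᴴ = -B) :
    (Matrix.trace (A * B)).re = 0 := by
  have h : star (Matrix.trace (A * B)) = -Matrix.trace (A * B) := by
    rw [← trace_conjTranspose, conjTranspose_mul, hA, hB, Matrix.neg_mul, trace_neg, trace_mul_comm]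
  have := congrArg Complex.re h
  simp at this
  linarith

theorem trace_im_zero {m : Type*} [Fintype m] (A B : Matrix m m ℂ) (hA : Aᴴ = A) (hB : Bᴴ = B) :
    (Matrix.trace (A * B)).im = 0 := by
  have h : star (Matrix.trace (A * B)) = Matrix.trace (A * B) := by
    rw [← trace_conjTranspose, conjTranspose_mul, hA, hB, trace_mul_comm]
  have := congrArg Complex.im h
  simp at this
  linarith

/-- The map `P(Z) = (Z_U − U·herm(Uᴴ Z_U), herm(Z_Σ))` is the orthogonal
projection onto the tangent space of `St_{p,k} × H^{++}_k` at `(U, Σ)`: (i) it lands in the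
tangent space, and (ii) the residual `Z − P(Z)` is orthogonal to every tangent vector with
respect to the proposed metric.  Here `Sig` plays the role of `Σ`. -/
theorem tangent_projection (p k : ℕ) (hk : 1 ≤ k) (hpk : k ≤ p)
    (U : Matrix (Fin p) (Fin k) ℂ) (hU : Uᴴ * U = 1)
    (Sig : Matrix (Fin k) (Fin k) ℂ) (hSig : Sig.PosDef)
    (α β : ℝ) (hα : 0 < α)
    (ZU : Matrix (Fin p) (Fin k) ℂ) (ZS : Matrix (Fin k) (Fin k) ℂ) :
    -- (i) P(Z) lies in the tangent space
    ((Uᴴ * (ZU - U * hermPart (Uᴴ * ZU)))ᴴ = -(Uᴴ * (ZU - U * hermPart (Uᴴ * ZU)))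
      ∧ (hermPart ZS).IsHermitian)
    -- (ii) the residual is orthogonal to every tangent vector
    ∧ (∀ (ξU : Matrix (Fin p) (Fin k) ℂ) (ξS : Matrix (Fin k) (Fin k) ℂ),
        (Uᴴ * ξU)ᴴ = -(Uᴴ * ξU) → ξS.IsHermitian →
        (Matrix.trace ((U * hermPart (Uᴴ * ZU))ᴴ *
            ((1 : Matrix (Fin p) (Fin p) ℂ) - (1/2 : ℂ) • (U * Uᴴ)) * ξU)).re
          + α * (Matrix.trace (Sig⁻¹ * skewhPart ZS * Sig⁻¹ * ξS)).re
          + β * (Matrix.trace (Sig⁻¹ * skewhPart ZS) * Matrix.trace (Sig⁻¹ * ξS)).re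
        = 0) := by
  refine ⟨⟨?_, hermPart_conj ZS⟩, ?_⟩
  · have e : Uᴴ * (ZU - U * hermPart (Uᴴ * ZU)) = skewhPart (Uᴴ * ZU) := by
      rw [Matrix.mul_sub, ← Matrix.mul_assoc, hU, Matrix.one_mul]
      simp only [hermPart, skewhPart]
      module
    rw [e, skewhPart_conj]
  · intro ξU ξS hξU hξS
    have hS : (Sig⁻¹)ᴴ = Sig⁻¹ := hSig.1.inv
    have e1 : (U * hermPart (Uᴴ * ZU))ᴴ *
            ((1 : Matrix (Fin p) (Fin p) ℂ) - (1/2 : ℂ) • (U * Uᴴ)) * ξU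
        = hermPart (Uᴴ * ZU) * ((1/2 : ℂ) • (Uᴴ * ξU)) := by
      have e0 : Uᴴ * ((1 : Matrix (Fin p) (Fin p) ℂ) - (1/2 : ℂ) • (U * Uᴴ))
          = (1/2 : ℂ) • Uᴴ := by
        rw [Matrix.mul_sub, Matrix.mul_one, Matrix.mul_smul, ← Matrix.mul_assoc, hU,
          Matrix.one_mul]
        module
      rw [conjTranspose_mul, hermPart_conj, Matrix.mul_assoc (hermPart _), e0, Matrix.mul_assoc,
        Matrix.smul_mul]
    have h1 := trace_re_zero (hermPart (Uᴴ * ZU)) ((1/2 : ℂ) • (Uᴴ * ξU)) (hermPart_conj _)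
      (by rw [conjTranspose_smul, hξU]; simp)
    have h2 := trace_re_zero ξS (Sig⁻¹ * skewhPart ZS * Sig⁻¹) hξS
      (by rw [conjTranspose_mul, conjTranspose_mul, hS, skewhPart_conj]; simp [Matrix.mul_assoc])
    have h3 := trace_re_zero Sig⁻¹ (skewhPart ZS) hS (skewhPart_conj _)
    have h4 := trace_im_zero Sig⁻¹ ξS hS hξS
    rw [trace_mul_comm] at h2
    rw [e1, h1, h2, Complex.mul_re, h3, h4]
    simp
end

section
/- Let p ≥ k ≥ 1, let U ∈ ℂ^{p×k} satisfy U^H U = I_k, let Σ be a k×k Hermitian positive definite complex matrix, and let α > 0, β be real numbers. Let (ξ_U, ξ_Σ) be a tangent vector, i.e. U^H ξ_U is skew-Hermitian and ξ_Σ is Hermitian. Then the following are equivalent: (i) for every skew-Hermitian Ω ∈ ℂ^{k×k}, Re tr(ξ_U^H (I_p − (1/2) U U^H)(U Ω)) + α Re tr(Σ^{-1} ξ_Σ Σ^{-1} (ΣΩ − ΩΣ)) + β Re(tr(Σ^{-1} ξ_Σ) · tr(Σ^{-1}(ΣΩ − ΩΣ))) = 0; (ii) U^H ξ_U = 2α(Σ^{-1}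 ξ_Σ − ξ_Σ Σ^{-1}). In other words, the horizontal space — the orthogonal complement of the vertical space {(UΩ, ΣΩ − ΩΣ) : Ω skew-Hermitian} with respect to the metric — is exactly {(ξ_U, ξ_Σ) tangent : U^H ξ_U = 2α(Σ^{-1} ξ_Σ − ξ_Σ Σ^{-1})}. -/
open Matrix
open scoped ComplexOrder

/-- Characterization of the horizontal space: a tangent vector
`(ξU, ξS)` at `(U, Σ)` is orthogonal to the whole vertical space
`{(UΩ, ΣΩ − ΩΣ) : Ω skew-Hermitian}` (with respect to the proposed metric) if and only if
`Uᴴ ξU = 2α (Σ⁻¹ ξΣ − ξΣ Σ⁻¹)`.  Here `Sig` plays the role of `Σ`. -/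
theorem horizontal_space_characterization (p k : ℕ) (hk : 1 ≤ k) (hpk : k ≤ p)
    (U : Matrix (Fin p) (Fin k) ℂ) (hU : Uᴴ * U = 1)
    (Sig : Matrix (Fin k) (Fin k) ℂ) (hSig : Sig.PosDef)
    (α β : ℝ) (hα : 0 < α)
    (ξU : Matrix (Fin p) (Fin k) ℂ) (ξS : Matrix (Fin k) (Fin k) ℂ)
    (hξU : (Uᴴ * ξU)ᴴ = -(Uᴴ * ξU)) (hξS : ξS.IsHermitian) :
    (∀ Ω : Matrix (Fin k) (Fin k) ℂ, Ωᴴ = -Ω →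
        (Matrix.trace (ξUᴴ * ((1 : Matrix (Fin p) (Fin p) ℂ) - (1/2 : ℂ) • (U * Uᴴ))
            * (U * Ω))).re
          + α * (Matrix.trace (Sig⁻¹ * ξS * Sig⁻¹ * (Sig * Ω - Ω * Sig))).re
          + β * (Matrix.trace (Sig⁻¹ * ξS)
              * Matrix.trace (Sig⁻¹ * (Sig * Ω - Ω * Sig))).re
        = 0)
    ↔ Uᴴ * ξU = (2 * α : ℝ) • (Sig⁻¹ * ξS - ξS * Sig⁻¹) := by
  have hdet : IsUnit Sig.det := (Matrix.isUnit_iff_isUnit_det _).1 hSig.isUnit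
  have h1 : Sig⁻¹ * Sig = 1 := Matrix.nonsing_inv_mul _ hdet
  have h2 : Sig * Sig⁻¹ = 1 := Matrix.mul_nonsing_inv _ hdet
  have hinv : (Sig⁻¹)ᴴ = Sig⁻¹ := hSig.isHermitian.inv
  have hξ : ξSᴴ = ξS := hξS
  obtain ⟨C, hC⟩ : ∃ C, C = Sig⁻¹ * ξS - ξS * Sig⁻¹ := ⟨_, rfl⟩
  obtain ⟨W, hW⟩ : ∃ W, W = Uᴴ * ξU := ⟨_, rfl⟩
  have hCs : Cᴴ = -C := by
    rw [hC, Matrix.conjTranspose_sub, Matrix.conjTranspose_mul, Matrix.conjTranspose_mul,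
      hinv, hξ, neg_sub]
  rw [← hC, ← hW]
  rw [← hW] at hξU
  have e1 : ∀ Ω : Matrix (Fin k) (Fin k) ℂ,
      ξUᴴ * ((1 : Matrix (Fin p) (Fin p) ℂ) - (1/2 : ℂ) • (U * Uᴴ)) * (U * Ω)
        = (-(1/2 : ℝ)) • (W * Ω) := by
    intro Ω
    have a : ξUᴴ * U = -W := by
      rw [← hξU, hW, Matrix.conjTranspose_mul, Matrix.conjTranspose_conjTranspose]
    have b : ((1 : Matrix (Fin p) (Fin p) ℂ) - (1/2 : ℂ) • (U * Uᴴ)) * U = (1/2 : ℝ) • U := by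
      rw [Matrix.sub_mul, Matrix.smul_mul, Matrix.mul_assoc, hU, Matrix.mul_one, Matrix.one_mul]
      ext i j
      simp
      ring
    rw [Matrix.mul_assoc, ← Matrix.mul_assoc _ U, b, Matrix.smul_mul, Matrix.mul_smul,
      ← Matrix.mul_assoc, a, Matrix.neg_mul, smul_neg, neg_smul]
  have e2 : ∀ Ω : Matrix (Fin k) (Fin k) ℂ,
      Matrix.trace (Sig⁻¹ * ξS * Sig⁻¹ * (Sig * Ω - Ω * Sig)) = Matrix.trace (C * Ω) := by
    intro Ω
    have a : Sig⁻¹ * ξS * Sig⁻¹ * (Sig * Ω) = Sig⁻¹ * ξS * Ω := by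
      rw [Matrix.mul_assoc _ Sig⁻¹, ← Matrix.mul_assoc Sig⁻¹ Sig, h1, Matrix.one_mul]
    have b : Matrix.trace (Sig⁻¹ * ξS * Sig⁻¹ * (Ω * Sig)) = Matrix.trace (ξS * Sig⁻¹ * Ω) := by
      rw [← Matrix.mul_assoc, Matrix.trace_mul_comm]
      simp only [← Matrix.mul_assoc]
      rw [h2, Matrix.one_mul]
    rw [Matrix.mul_sub, Matrix.trace_sub, a, b, hC, Matrix.sub_mul, Matrix.trace_sub]
  have e3 : ∀ Ω : Matrix (Fin k) (Fin k) ℂ,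
      Matrix.trace (Sig⁻¹ * (Sig * Ω - Ω * Sig)) = 0 := by
    intro Ω
    rw [Matrix.mul_sub, Matrix.trace_sub, ← Matrix.mul_assoc, h1, ← Matrix.mul_assoc,
      Matrix.trace_mul_comm (Sig⁻¹ * Ω), ← Matrix.mul_assoc, h2, sub_self]
  have key : ∀ Ω : Matrix (Fin k) (Fin k) ℂ,
      (Matrix.trace (ξUᴴ * ((1 : Matrix (Fin p) (Fin p) ℂ) - (1/2 : ℂ) • (U * Uᴴ))
            * (U * Ω))).re
          + α * (Matrix.trace (Sig⁻¹ * ξS * Sig⁻¹ * (Sig * Ω - Ω * Sig))).re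
          + β * (Matrix.trace (Sig⁻¹ * ξS)
              * Matrix.trace (Sig⁻¹ * (Sig * Ω - Ω * Sig))).re
        = -(1/2) * (Matrix.trace ((W - (2 * α : ℝ) • C) * Ω)).re := by
    intro Ω
    rw [e1, e2, e3, Matrix.sub_mul, Matrix.smul_mul, Matrix.trace_sub, Matrix.trace_smul,
      Matrix.trace_smul, Complex.sub_re, Complex.smul_re, Complex.smul_re, mul_zero,
      Complex.zero_re, smul_eq_mul, smul_eq_mul]
    ring
  simp only [key]
  constructor
  · intro h
    have hD : (W - (2 * α : ℝ) • C)ᴴ = -(W - (2 * α : ℝ) • C) := by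
      rw [Matrix.conjTranspose_sub, Matrix.conjTranspose_smul, hξU, hCs, star_trivial, smul_neg]
      abel
    have h3 := h _ hD
    rw [← sub_eq_zero]
    generalize W - (2 * α : ℝ) • C = D at hD h3
    have h4 : (Matrix.trace (Dᴴ * D)).re = 0 := by
      rw [hD, Matrix.neg_mul, Matrix.trace_neg, Complex.neg_re]
      linarith
    have h5 : 0 ≤ Matrix.trace (Dᴴ * D) := (Matrix.posSemidef_conjTranspose_mul_self D).trace_nonneg
    apply Matrix.trace_conjTranspose_mul_self_eq_zero_iff.1
    exact Complex.ext h4 (Complex.le_def.1 h5).2.symm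
  · intro h Ω _
    rw [h, sub_self, Matrix.zero_mul, Matrix.trace_zero, Complex.zero_re, mul_zero]
end

section
/- Let k ≥ 1, let Σ be a k×k Hermitian positive definite complex matrix, and let α > 0 be real. Then the real-linear map L on ℂ^{k×k} defined by L(Ω) = (1 − 4α)Ω + 2α(Σ^{-1} Ω Σ + Σ Ω Σ^{-1}) is bijective: for every B ∈ ℂ^{k×k} there exists a unique Ω ∈ ℂ^{k×k} with (1 − 4α)Ω + 2α(Σ^{-1} Ω Σ + Σ Ω Σ^{-1}) = B. Moreover, if B is skew-Hermitian then the unique solution Ω is skew-Hermitian. -/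
open Matrix
open scoped ComplexOrder

theorem hp_kernel {k : ℕ} (Sig : Matrix (Fin k) (Fin k) ℂ) (hSig : Sig.PosDef)
    (α : ℝ) (hα : 0 < α) (W : Matrix (Fin k) (Fin k) ℂ)
    (h : (1 - 4 * α : ℝ) • W + (2 * α : ℝ) • (Sig⁻¹ * W * Sig + Sig * W * Sig⁻¹) = 0) :
    W = 0 := by
  obtain ⟨U, V, l, hUV, hVU, hl, hS⟩ : ∃ (U V : Matrix (Fin k) (Fin k) ℂ) (l : Fin k → ℝ),
      U * V = 1 ∧ V * U = 1 ∧ (∀ i, 0 < l i) ∧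
      Sig = U * diagonal (fun i => (l i : ℂ)) * V := by
    refine ⟨hSig.1.eigenvectorUnitary, star (hSig.1.eigenvectorUnitary : Matrix _ _ ℂ),
      hSig.1.eigenvalues, ?_, ?_, fun i => hSig.eigenvalues_pos i, ?_⟩
    · exact Unitary.mul_star_self_of_mem hSig.1.eigenvectorUnitary.2
    · exact Unitary.star_mul_self_of_mem hSig.1.eigenvectorUnitary.2
    · have := hSig.1.spectral_theorem
      rw [Unitary.conjStarAlgAut_apply] at this
      exact this
  have hDD : diagonal (fun i => (l i : ℂ)) * diagonal (fun i => ((l i)⁻¹ : ℂ)) = 1 := by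
    rw [diagonal_mul_diagonal, ← diagonal_one]
    congr 1
    funext i
    exact mul_inv_cancel₀ (by exact_mod_cast (hl i).ne')
  generalize hD : diagonal (fun i => (l i : ℂ)) = D at hS hDD
  generalize hE : diagonal (fun i => ((l i)⁻¹ : ℂ)) = E at hDD
  have hI : Sig⁻¹ = U * E * V := by
    apply inv_eq_right_inv
    rw [hS]
    calc U * D * V * (U * E * V) = U * D * (V * U) * E * V := by simp only [Matrix.mul_assoc]
      _ = U * (D * E) * V := by rw [hVU]; simp only [Matrix.mul_assoc, Matrix.mul_one]
      _ = 1 := by rw [hDD, Matrix.mul_one, hUV]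
  have key : (1 - 4 * α : ℝ) • (V * W * U)
      + (2 * α : ℝ) • (E * (V * W * U) * D + D * (V * W * U) * E) = 0 := by
    have e1 : V * (Sig⁻¹ * W * Sig) * U = E * (V * W * U) * D := by
      rw [hI, hS]
      calc _ = (V * U) * E * (V * W * U) * D * (V * U) := by simp only [Matrix.mul_assoc]
        _ = _ := by rw [hVU, Matrix.mul_one, Matrix.one_mul]
    have e2 : V * (Sig * W * Sig⁻¹) * U = D * (V * W * U) * E := by
      rw [hI, hS]
      calc _ = (V * U) * D * (V * W * U) * E * (V * U) := by simp only [Matrix.mul_assoc]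
        _ = _ := by rw [hVU, Matrix.mul_one, Matrix.one_mul]
    have := congrArg (fun X => V * X * U) h
    simp only [Matrix.mul_add, Matrix.add_mul, Matrix.mul_smul, Matrix.smul_mul, Matrix.mul_zero,
      Matrix.zero_mul, smul_add, e1, e2] at this
    rw [smul_add]
    exact this
  have hM : V * W * U = 0 := by
    generalize V * W * U = M at key
    ext i j
    have hij := congrFun (congrFun key i) j
    rw [← hD, ← hE] at hij
    simp only [Matrix.add_apply, Matrix.smul_apply, mul_diagonal, diagonal_mul,
      Matrix.zero_apply, Complex.real_smul] at hij ⊢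
    have hpos : 0 < (1 - 4 * α) + 2 * α * ((l i)⁻¹ * l j + l i * (l j)⁻¹) := by
      have h2 : 2 ≤ (l i)⁻¹ * l j + l i * (l j)⁻¹ := by
        have hi := hl i
        have hj := hl j
        have : (l i)⁻¹ * l j + l i * (l j)⁻¹ - 2 = (l i - l j)^2 / (l i * l j) := by
          field_simp
          ring
        have : 0 ≤ (l i - l j)^2 / (l i * l j) := by positivity
        linarith
      nlinarith
    have hne : (((1 - 4 * α) + 2 * α * ((l i)⁻¹ * l j + l i * (l j)⁻¹) : ℝ) : ℂ) ≠ 0 := by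
      exact_mod_cast hpos.ne'
    refine (mul_eq_zero.mp ?_).resolve_left hne
    rw [← hij]
    push_cast
    ring
  calc W = (U * V) * W * (U * V) := by rw [hUV, Matrix.mul_one, Matrix.one_mul]
    _ = U * (V * W * U) * V := by simp only [Matrix.mul_assoc]
    _ = 0 := by rw [hM, Matrix.mul_zero, Matrix.zero_mul]

/-- For a Hermitian positive definite `Σ` (here `Sig`) and `α > 0`, the
real-linear map `Ω ↦ (1 − 4α)Ω + 2α(Σ⁻¹ Ω Σ + Σ Ω Σ⁻¹)` on `ℂ^{k×k}` is bijective: every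
`B` has a unique preimage, and if `B` is skew-Hermitian then so is its preimage. -/
theorem horizontal_projection_linear_map_bijective (k : ℕ) (hk : 1 ≤ k)
    (Sig : Matrix (Fin k) (Fin k) ℂ) (hSig : Sig.PosDef)
    (α : ℝ) (hα : 0 < α) :
    (∀ B : Matrix (Fin k) (Fin k) ℂ,
      ∃! Ω : Matrix (Fin k) (Fin k) ℂ,
        (1 - 4 * α : ℝ) • Ω + (2 * α : ℝ) • (Sig⁻¹ * Ω * Sig + Sig * Ω * Sig⁻¹) = B)
    ∧ (∀ B : Matrix (Fin k) (Fin k) ℂ, Bᴴ = -B →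
        ∀ Ω : Matrix (Fin k) (Fin k) ℂ,
          (1 - 4 * α : ℝ) • Ω + (2 * α : ℝ) • (Sig⁻¹ * Ω * Sig + Sig * Ω * Sig⁻¹) = B →
          Ωᴴ = -Ω) := by
  let L : Matrix (Fin k) (Fin k) ℂ →ₗ[ℝ] Matrix (Fin k) (Fin k) ℂ :=
    { toFun := fun W =>
        (1 - 4 * α : ℝ) • W + (2 * α : ℝ) • (Sig⁻¹ * W * Sig + Sig * W * Sig⁻¹)
      map_add' := by
        intro x y
        simp only [Matrix.mul_add, Matrix.add_mul, smul_add]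
        abel
      map_smul' := by
        intro c x
        simp only [Matrix.mul_smul, Matrix.smul_mul, smul_add, RingHom.id_apply]
        simp only [smul_comm c] }
  have hinj : Function.Injective L := by
    rw [injective_iff_map_eq_zero]
    intro W hW
    exact hp_kernel Sig hSig α hα W hW
  have hsurj : Function.Surjective L := LinearMap.injective_iff_surjective.mp hinj
  refine ⟨fun B => ?_, fun B hB W hW => ?_⟩
  · obtain ⟨W, hW⟩ := hsurj B
    exact ⟨W, hW, fun W' hW' => hinj (Eq.trans hW' hW.symm)⟩
  · apply hinj
    have h1 : L (-W) = -B := by rw [map_neg]; exact congrArg Neg.neg hW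
    rw [h1, ← hB, ← hW]
    change (1 - 4 * α : ℝ) • Wᴴ + (2 * α : ℝ) • (Sig⁻¹ * Wᴴ * Sig + Sig * Wᴴ * Sig⁻¹) = _
    have hS : Sigᴴ = Sig := hSig.1
    simp only [conjTranspose_add, conjTranspose_smul, conjTranspose_mul,
      conjTranspose_nonsing_inv, hS, star_trivial, Matrix.mul_assoc]
    rw [add_comm (Sig * (Wᴴ * Sig⁻¹))]
end

section
/- Let p ≥ k ≥ 1, let U ∈ ℂ^{p×k} with U^H U = I_k, let Σ be a k×k Hermitian positive definite complex matrix, let α > 0, and let (ξ_U, ξ_Σ) be a tangent vector (U^H ξ_U skew-Hermitian, ξ_Σ Hermitian). Then there exists a unique skew-Hermitian Ω ∈ ℂ^{k×k} such that the pair (ξ_U − UΩ, ξ_Σ + ΩΣ − ΣΩ) is horizontal, i.e. satisfies U^H(ξ_U − UΩ) = 2α(Σ^{-1}(ξ_Σ + ΩΣ − ΣΩ) − (ξ_Σ + ΩΣ − ΣΩ)Σ^{-1}). Equivalently, Ω is the unique skew-Hermitian solution of (1 − 4α)Ω + 2α(Σ^{-1} Ω Σ + Σ Ω Σ^{-1})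 = U^H ξ_U + 2α(ξ_Σ Σ^{-1} − Σ^{-1} ξ_Σ). -/
open Matrix
open scoped ComplexOrder

lemma aux_inj {k : ℕ} (Sig : Matrix (Fin k) (Fin k) ℂ) (hSig : Sig.PosDef)
    (α : ℝ) (hα : 0 < α) (Ω : Matrix (Fin k) (Fin k) ℂ)
    (h : (1 - 4 * α : ℝ) • Ω + (2 * α : ℝ) • (Sig⁻¹ * Ω * Sig + Sig * Ω * Sig⁻¹) = 0) :
    Ω = 0 := by
  obtain ⟨V, W, d, hd, hVW, hWV, hS⟩ : ∃ (V W : Matrix (Fin k) (Fin k) ℂ) (d : Fin k → ℝ),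
      (∀ i, 0 < d i) ∧ V * W = 1 ∧ W * V = 1 ∧
        Sig = V * diagonal (fun i => (d i : ℂ)) * W := by
    refine ⟨hSig.1.eigenvectorUnitary, star hSig.1.eigenvectorUnitary, hSig.1.eigenvalues,
      hSig.eigenvalues_pos, ?_, ?_, ?_⟩
    · exact Unitary.coe_mul_star_self _
    · exact Unitary.coe_star_mul_self _
    · exact hSig.1.spectral_theorem
  have hS' : Sig⁻¹ = V * diagonal (fun i => ((d i)⁻¹ : ℂ)) * W := by
    apply Matrix.inv_eq_right_inv
    rw [hS]
    calc _ = V * diagonal (fun i => (d i : ℂ)) * (W * V) * diagonal (fun i => ((d i)⁻¹ : ℂ)) * W := by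
          simp only [Matrix.mul_assoc]
      _ = 1 := by
          rw [hWV, Matrix.mul_one, Matrix.mul_assoc V, diagonal_mul_diagonal]
          have : (fun i => (d i : ℂ) * ((d i)⁻¹ : ℂ)) = fun _ => 1 := by
            funext i
            exact mul_inv_cancel₀ (by exact_mod_cast (hd i).ne')
          rw [this, diagonal_one, Matrix.mul_one, hVW]
  have h1 : W * (Sig⁻¹ * Ω * Sig) * V
      = diagonal (fun i => ((d i)⁻¹ : ℂ)) * (W * Ω * V) * diagonal (fun i => (d i : ℂ)) := by
    rw [hS', hS]
    calc _ = (W * V) * diagonal (fun i => ((d i)⁻¹ : ℂ)) * (W * Ω * V)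
            * diagonal (fun i => (d i : ℂ)) * (W * V) := by simp only [Matrix.mul_assoc]
      _ = _ := by rw [hWV, Matrix.mul_one, Matrix.one_mul]
  have h2 : W * (Sig * Ω * Sig⁻¹) * V
      = diagonal (fun i => (d i : ℂ)) * (W * Ω * V) * diagonal (fun i => ((d i)⁻¹ : ℂ)) := by
    rw [hS', hS]
    calc _ = (W * V) * diagonal (fun i => (d i : ℂ)) * (W * Ω * V)
            * diagonal (fun i => ((d i)⁻¹ : ℂ)) * (W * V) := by simp only [Matrix.mul_assoc]
      _ = _ := by rw [hWV, Matrix.mul_one, Matrix.one_mul]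
  have hX : W * Ω * V = 0 := by
    have h3 := congrArg (fun M => W * M * V) h
    simp only [Matrix.mul_add, Matrix.add_mul, Matrix.mul_smul, Matrix.smul_mul, h1, h2,
      Matrix.mul_zero, Matrix.zero_mul] at h3
    ext i j
    have h4 := congrFun (congrFun h3 i) j
    simp only [Matrix.add_apply, Matrix.smul_apply, Matrix.mul_diagonal, Matrix.diagonal_mul,
      Matrix.zero_apply, Complex.real_smul] at h4
    have h5 : ((1 - 4 * α + 2 * α * ((d i)⁻¹ * d j + d i * (d j)⁻¹) : ℝ) : ℂ)
        * (W * Ω * V) i j = 0 := by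
      rw [← h4]; push_cast; ring
    have hpos : 0 < 1 - 4 * α + 2 * α * ((d i)⁻¹ * d j + d i * (d j)⁻¹) := by
      have hi := hd i
      have hj := hd j
      have : 1 - 4 * α + 2 * α * ((d i)⁻¹ * d j + d i * (d j)⁻¹)
          = 1 + 2 * α * ((d i - d j) ^ 2 * ((d i)⁻¹ * (d j)⁻¹)) := by
        field_simp; ring
      rw [this]; positivity
    rcases mul_eq_zero.1 h5 with h6 | h6
    · exact absurd (by exact_mod_cast h6) hpos.ne'
    · simpa using h6
  calc Ω = (V * W) * Ω * (V * W) := by rw [hVW, Matrix.mul_one, Matrix.one_mul]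
    _ = V * (W * Ω * V) * W := by simp only [Matrix.mul_assoc]
    _ = 0 := by rw [hX]; simp

/-- Orthogonal projection of a tangent vector onto the horizontal space:
there is a unique skew-Hermitian `Ω` such that `(ξU − UΩ, ξΣ + ΩΣ − ΣΩ)` is horizontal,
and for skew-Hermitian `Ω` horizontality is equivalent to the linear equation
`(1 − 4α)Ω + 2α(Σ⁻¹ΩΣ + ΣΩΣ⁻¹) = Uᴴ ξU + 2α(ξΣ Σ⁻¹ − Σ⁻¹ ξΣ)`.
Here `Sig` plays the role of `Σ`. -/
theorem horizontal_projection_exists_unique (p k : ℕ) (hk : 1 ≤ k) (hpk : k ≤ p)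
    (U : Matrix (Fin p) (Fin k) ℂ) (hU : Uᴴ * U = 1)
    (Sig : Matrix (Fin k) (Fin k) ℂ) (hSig : Sig.PosDef)
    (α : ℝ) (hα : 0 < α)
    (ξU : Matrix (Fin p) (Fin k) ℂ) (ξS : Matrix (Fin k) (Fin k) ℂ)
    (hξU : (Uᴴ * ξU)ᴴ = -(Uᴴ * ξU)) (hξS : ξS.IsHermitian) :
    (∃! Ω : Matrix (Fin k) (Fin k) ℂ, Ωᴴ = -Ω ∧
        Uᴴ * (ξU - U * Ω)
          = (2 * α : ℝ) • (Sig⁻¹ * (ξS + Ω * Sig - Sig * Ω)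
              - (ξS + Ω * Sig - Sig * Ω) * Sig⁻¹))
    ∧ (∀ Ω : Matrix (Fin k) (Fin k) ℂ, Ωᴴ = -Ω →
        (Uᴴ * (ξU - U * Ω)
            = (2 * α : ℝ) • (Sig⁻¹ * (ξS + Ω * Sig - Sig * Ω)
                - (ξS + Ω * Sig - Sig * Ω) * Sig⁻¹)
          ↔ (1 - 4 * α : ℝ) • Ω + (2 * α : ℝ) • (Sig⁻¹ * Ω * Sig + Sig * Ω * Sig⁻¹)
              = Uᴴ * ξU + (2 * α : ℝ) • (ξS * Sig⁻¹ - Sig⁻¹ * ξS))) := by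
  have hdet : IsUnit Sig.det := (Matrix.isUnit_iff_isUnit_det _).1 hSig.isUnit
  have hiff : ∀ Ω : Matrix (Fin k) (Fin k) ℂ,
        (Uᴴ * (ξU - U * Ω)
            = (2 * α : ℝ) • (Sig⁻¹ * (ξS + Ω * Sig - Sig * Ω)
                - (ξS + Ω * Sig - Sig * Ω) * Sig⁻¹)
          ↔ (1 - 4 * α : ℝ) • Ω + (2 * α : ℝ) • (Sig⁻¹ * Ω * Sig + Sig * Ω * Sig⁻¹)
              = Uᴴ * ξU + (2 * α : ℝ) • (ξS * Sig⁻¹ - Sig⁻¹ * ξS)) := by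
    intro Ω
    have e1 : Uᴴ * (ξU - U * Ω) = Uᴴ * ξU - Ω := by
      rw [Matrix.mul_sub, ← Matrix.mul_assoc, hU, Matrix.one_mul]
    have e2 : Sig⁻¹ * (ξS + Ω * Sig - Sig * Ω) = Sig⁻¹ * ξS + Sig⁻¹ * Ω * Sig - Ω := by
      rw [Matrix.mul_sub, Matrix.mul_add, ← Matrix.mul_assoc, ← Matrix.mul_assoc,
        Matrix.nonsing_inv_mul _ hdet, Matrix.one_mul]
    have e3 : (ξS + Ω * Sig - Sig * Ω) * Sig⁻¹ = ξS * Sig⁻¹ + Ω - Sig * Ω * Sig⁻¹ := by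
      rw [Matrix.sub_mul, Matrix.add_mul, Matrix.mul_assoc Ω,
        Matrix.mul_nonsing_inv _ hdet, Matrix.mul_one]
    rw [e1, e2, e3, ← sub_eq_zero, ← sub_eq_zero (b := Uᴴ * ξU + _), ← neg_eq_zero]
    apply Eq.congr_left
    module
  refine ⟨?_, fun Ω _ => hiff Ω⟩
  simp only [hiff]
  let L : Matrix (Fin k) (Fin k) ℂ →ₗ[ℝ] Matrix (Fin k) (Fin k) ℂ :=
    { toFun := fun Ω => (1 - 4 * α : ℝ) • Ω
        + (2 * α : ℝ) • (Sig⁻¹ * Ω * Sig + Sig * Ω * Sig⁻¹)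
      map_add' := by
        intro x y
        simp only [Matrix.mul_add, Matrix.add_mul]
        module
      map_smul' := by
        intro c x
        simp only [Matrix.mul_smul, Matrix.smul_mul, RingHom.id_apply]
        module }
  have hLinj : Function.Injective L := by
    rw [← LinearMap.ker_eq_bot, LinearMap.ker_eq_bot']
    exact fun Ω h => aux_inj Sig hSig α hα Ω h
  have : FiniteDimensional ℝ (Matrix (Fin k) (Fin k) ℂ) :=
    Module.Finite.trans ℂ _
  obtain ⟨Ω, hΩ⟩ := (LinearMap.injective_iff_surjective.1 hLinj)
    (Uᴴ * ξU + (2 * α : ℝ) • (ξS * Sig⁻¹ - Sig⁻¹ * ξS))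
  refine ⟨Ω, ⟨?_, hΩ⟩, fun Y hY => hLinj (hY.2.trans hΩ.symm)⟩
  have hSH : Sigᴴ = Sig := hSig.1
  have hSiH : (Sig⁻¹)ᴴ = Sig⁻¹ := by rw [Matrix.conjTranspose_nonsing_inv, hSH]
  have hXH : ξSᴴ = ξS := hξS
  have hc : (L Ω)ᴴ = L Ωᴴ := by
    change ((1 - 4 * α : ℝ) • Ω + (2 * α : ℝ) • (Sig⁻¹ * Ω * Sig + Sig * Ω * Sig⁻¹))ᴴ
      = (1 - 4 * α : ℝ) • Ωᴴ + (2 * α : ℝ) • (Sig⁻¹ * Ωᴴ * Sig + Sig * Ωᴴ * Sig⁻¹)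
    simp only [Matrix.conjTranspose_add, Matrix.conjTranspose_smul, Matrix.conjTranspose_mul,
      hSH, hSiH, star_trivial, Matrix.mul_assoc]
    module
  apply hLinj
  rw [← hc, map_neg, hΩ, Matrix.conjTranspose_add, hξU, Matrix.conjTranspose_smul,
    Matrix.conjTranspose_sub, Matrix.conjTranspose_mul, Matrix.conjTranspose_mul, hSiH, hXH,
    star_trivial]
  module
end

section
/- Let p ≥ 2k ≥ 2. Let U, Q ∈ ℂ^{p×k} satisfy U^H U = I_k, Q^H Q = I_k and U^H Q = 0, let A ∈ ℂ^{k×k} be skew-Hermitian and R ∈ ℂ^{k×k} be arbitrary. Let S be the 2k×2k block matrix S = [[A, −R^H],[R, 0]], and define U(t) = [U Q] exp(tS) [I_k; 0] for t ∈ ℝ (where [U Q] ∈ ℂ^{p×2k} is the horizontal concatenation and [I_k; 0] ∈ ℂ^{2k×k} is vertical concatenation). Then: (i) S is skew-Hermitian and exp(tS) is unitary for every t; (ii) U(t)^H U(t) = I_k for every t ∈ ℝ; (iii) U(0) = U; (iv) t ↦ U(t) is differentiable with U'(t) = [U Q] exp(tS) S [I_k; 0], and U(t)^H U'(t) = A for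 every t; in particular U'(0) = UA + QR. -/
open Matrix
open scoped ComplexOrder

open scoped Matrix.Norms.Operator in
theorem entry_hasDerivAt_aux {p m k : Type*} [Fintype m] [DecidableEq m]
    (B : Matrix p m ℂ) (S : Matrix m m ℂ) (J : Matrix m k ℂ) (t : ℝ) (i : p) (j : k) :
    HasDerivAt (fun s : ℝ => (B * NormedSpace.exp ((s : ℂ) • S) * J) i j)
      ((B * NormedSpace.exp ((t : ℂ) • S) * S * J) i j) t := by
  have h := hasDerivAt_exp_smul_const (𝕂 := ℂ) S (t : ℂ)
  let L : Matrix m m ℂ →ₗ[ℂ] ℂ :=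
    { toFun := fun M => (B * M * J) i j
      map_add' := fun x y => by simp [Matrix.mul_add, Matrix.add_mul]
      map_smul' := fun c x => by simp }
  have h2 := (LinearMap.toContinuousLinearMap L).hasFDerivAt.comp_hasDerivAt (t : ℂ) h
  have h3 := h2.comp_ofReal
  rw [Matrix.mul_assoc B]
  exact h3

/-- The geodesic of the complex Stiefel manifold with its canonical metric:
`U(t) = [U Q] exp(tS) [I; 0]` with `S = [[A, −Rᴴ],[R, 0]]`, `A` skew-Hermitian.  Then `S` is
skew-Hermitian and `exp(tS)` unitary, `U(t)` stays on the Stiefel manifold, `U(0) = U`,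
`U(t)` is differentiable with `U'(t) = [U Q] exp(tS) S [I; 0]`, `U(t)ᴴ U'(t) = A` for all
`t`, and `U'(0) = UA + QR`. -/
theorem stiefel_geodesic (p k : ℕ) (hk : 1 ≤ k) (hp : 2 * k ≤ p)
    (U Q : Matrix (Fin p) (Fin k) ℂ)
    (hU : Uᴴ * U = 1) (hQ : Qᴴ * Q = 1) (hUQ : Uᴴ * Q = 0)
    (A R : Matrix (Fin k) (Fin k) ℂ) (hA : Aᴴ = -A) :
    ∀ (S : Matrix (Fin k ⊕ Fin k) (Fin k ⊕ Fin k) ℂ)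
      (UC : Matrix (Fin p) (Fin k ⊕ Fin k) ℂ)
      (J : Matrix (Fin k ⊕ Fin k) (Fin k) ℂ),
      S = Matrix.fromBlocks A (-Rᴴ) R 0 →
      UC = Matrix.fromCols U Q →
      J = Matrix.fromRows (1 : Matrix (Fin k) (Fin k) ℂ) (0 : Matrix (Fin k) (Fin k) ℂ) →
      -- (i) S skew-Hermitian, exp(tS) unitary
      (Sᴴ = -S
        ∧ ∀ t : ℝ, (NormedSpace.exp ((t : ℂ) • S))ᴴ * NormedSpace.exp ((t : ℂ) • S) = 1
            ∧ NormedSpace.exp ((t : ℂ) • S) * (NormedSpace.exp ((t : ℂ) • S))ᴴ = 1)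
      -- (ii) U(t) stays on the Stiefel manifold
      ∧ (∀ t : ℝ, (UC * NormedSpace.exp ((t : ℂ) • S) * J)ᴴ
            * (UC * NormedSpace.exp ((t : ℂ) • S) * J) = 1)
      -- (iii) initial value
      ∧ UC * NormedSpace.exp ((0 : ℂ) • S) * J = U
      -- (iv) derivative, constancy of U(t)ᴴ U'(t), and initial velocity
      ∧ (∀ (t : ℝ) (i : Fin p) (j : Fin k),
          HasDerivAt (fun s : ℝ => (UC * NormedSpace.exp ((s : ℂ) • S) * J) i j)
            ((UC * NormedSpace.exp ((t : ℂ) • S) * S * J) i j) t)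
      ∧ (∀ t : ℝ, (UC * NormedSpace.exp ((t : ℂ) • S) * J)ᴴ
            * (UC * NormedSpace.exp ((t : ℂ) • S) * S * J) = A)
      ∧ UC * NormedSpace.exp ((0 : ℂ) • S) * S * J = U * A + Q * R := by
  intro S UC J hS hUC hJ
  have hQU : Qᴴ * U = 0 := by
    have := congrArg conjTranspose hUQ
    simpa using this
  have hSS : Sᴴ = -S := by
    rw [hS, fromBlocks_conjTranspose, fromBlocks_neg]
    simp [hA]
  have hE : ∀ t : ℝ, (NormedSpace.exp ((t : ℂ) • S))ᴴ = NormedSpace.exp (-((t : ℂ) • S)) := by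
    intro t
    rw [← Matrix.exp_conjTranspose, conjTranspose_smul, hSS]
    simp
  have h1 : ∀ t : ℝ, (NormedSpace.exp ((t : ℂ) • S))ᴴ * NormedSpace.exp ((t : ℂ) • S) = 1 := by
    intro t
    rw [hE, ← Matrix.exp_add_of_commute _ _ (Commute.refl ((t : ℂ) • S)).neg_left]
    simp
  have hUC1 : UCᴴ * UC = 1 := by
    rw [hUC, conjTranspose_fromCols_eq_fromRows_conjTranspose, fromRows_mul_fromCols,
      hU, hQ, hUQ, hQU, fromBlocks_one]
  have hJJ : Jᴴ * J = 1 := by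
    rw [hJ, conjTranspose_fromRows_eq_fromCols_conjTranspose, fromCols_mul_fromRows]
    simp
  have hSJ : S * J = fromRows A R := by
    rw [hS, hJ, fromBlocks_mul_fromRows]
    simp
  have hJSJ : Jᴴ * (S * J) = A := by
    rw [hSJ, hJ, conjTranspose_fromRows_eq_fromCols_conjTranspose, fromCols_mul_fromRows]
    simp
  have key : ∀ (t : ℝ) (X : Matrix (Fin k ⊕ Fin k) (Fin k) ℂ),
      (UC * NormedSpace.exp ((t : ℂ) • S) * J)ᴴ * (UC * NormedSpace.exp ((t : ℂ) • S) * X)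
        = Jᴴ * X := by
    intro t X
    have e := h1 t
    generalize NormedSpace.exp ((t : ℂ) • S) = E at e ⊢
    calc _ = Jᴴ * (Eᴴ * (UCᴴ * UC) * E) * X := by
          simp only [conjTranspose_mul, Matrix.mul_assoc]
      _ = _ := by rw [hUC1, Matrix.mul_one, e, Matrix.mul_one]
  refine ⟨⟨hSS, fun t => ⟨h1 t, mul_eq_one_comm.mp (h1 t)⟩⟩, fun t => ?_, ?_, ?_, fun t => ?_, ?_⟩
  · rw [key, hJJ]
  · rw [zero_smul, NormedSpace.exp_zero, Matrix.mul_one, hUC, hJ, fromCols_mul_fromRows]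
    simp
  · exact fun t i j => entry_hasDerivAt_aux UC S J t i j
  · rw [Matrix.mul_assoc _ S J, key, hJSJ]
  · rw [zero_smul, NormedSpace.exp_zero, Matrix.mul_one, Matrix.mul_assoc, hSJ, hUC,
      fromCols_mul_fromRows]
end

section
/- Let p ≥ k ≥ 1, let U ∈ ℂ^{p×k} with U^H U = I_k, let Σ be a k×k Hermitian positive definite complex matrix, and let α > 0, β > −α/k be real (so α + kβ > 0). For arbitrary G_U ∈ ℂ^{p×k} and G_Σ ∈ ℂ^{k×k}, define grad = (G_U − U G_U^H U, (1/α) Σ herm(G_Σ) Σ − (β · tr(herm(G_Σ)Σ)/(α(α+kβ))) Σ). Then: (i) grad is a tangent vector at (U,Σ): U^H(G_U − U G_U^H U) is skew-Hermitian and the second component is Hermitian; (ii) for every tangent vector (ξ_U, ξ_Σ) (U^H ξ_U skew-Hermitian, ξ_Σ Hermitian), ⟨grad, ξ⟩_{(U,Σ)} = Re tr(G_U^H ξ_U) + Re tr(G_Σ^H ξ_Σ), where ⟨·,·⟩_{(U,Σ)} is the Riemannian metric. That is, grad is the Riemannian gradient corresponding to a function whose Euclidean gradient is (G_U, G_Σ).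 -/
open Matrix
open scoped ComplexOrder

/-- The Riemannian gradient: given an arbitrary Euclidean gradient
`(GU, GΣ)`, the pair
`grad = (GU − U GUᴴ U, (1/α) Σ herm(GΣ) Σ − (β tr(herm(GΣ)Σ)/(α(α+kβ))) Σ)`
is a tangent vector at `(U, Σ)` and satisfies
`⟨grad, ξ⟩_{(U,Σ)} = Re tr(GUᴴ ξU) + Re tr(GΣᴴ ξΣ)` for every tangent vector `(ξU, ξΣ)`.
Here `Sig` plays the role of `Σ`. -/
theorem riemannian_gradient (p k : ℕ) (hk : 1 ≤ k) (hpk : k ≤ p)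
    (U : Matrix (Fin p) (Fin k) ℂ) (hU : Uᴴ * U = 1)
    (Sig : Matrix (Fin k) (Fin k) ℂ) (hSig : Sig.PosDef)
    (α β : ℝ) (hα : 0 < α) (hβ : -(α / k) < β)
    (GU : Matrix (Fin p) (Fin k) ℂ) (GS : Matrix (Fin k) (Fin k) ℂ) :
    ∀ gradU : Matrix (Fin p) (Fin k) ℂ, ∀ gradS : Matrix (Fin k) (Fin k) ℂ,
      gradU = GU - U * GUᴴ * U →
      gradS = (α⁻¹ : ℝ) • (Sig * hermPart GS * Sig)
        - (β / (α * (α + k * β)) : ℝ) • (Matrix.trace (hermPart GS * Sig) • Sig) →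
      -- (i) grad is a tangent vector
      ((Uᴴ * gradU)ᴴ = -(Uᴴ * gradU) ∧ gradS.IsHermitian)
      -- (ii) grad represents the Euclidean gradient through the metric
      ∧ (∀ (ξU : Matrix (Fin p) (Fin k) ℂ) (ξS : Matrix (Fin k) (Fin k) ℂ),
          (Uᴴ * ξU)ᴴ = -(Uᴴ * ξU) → ξS.IsHermitian →
          (Matrix.trace (gradUᴴ * ((1 : Matrix (Fin p) (Fin p) ℂ) - (1/2 : ℂ) • (U * Uᴴ))
              * ξU)).re
            + α * (Matrix.trace (Sig⁻¹ * gradS * Sig⁻¹ * ξS)).re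
            + β * ((Matrix.trace (Sig⁻¹ * gradS)).re * (Matrix.trace (Sig⁻¹ * ξS)).re)
          = (Matrix.trace (GUᴴ * ξU)).re + (Matrix.trace (GSᴴ * ξS)).re) := by
  intro gradU gradS hgU hgS
  have hS : Sigᴴ = Sig := hSig.1
  have hH : (hermPart GS)ᴴ = hermPart GS := by
    simp [hermPart, conjTranspose_add, conjTranspose_smul, add_comm]
  have hdet : IsUnit Sig.det := hSig.isUnit.map Matrix.detMonoidHom
  have hl : Sig⁻¹ * Sig = 1 := Matrix.nonsing_inv_mul _ hdet
  have hr : Sig * Sig⁻¹ = 1 := Matrix.mul_nonsing_inv _ hdet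
  have hk0 : (0 : ℝ) < k := by exact_mod_cast hk
  have hpos : 0 < α + k * β := by
    have h1 := mul_lt_mul_of_pos_left hβ hk0
    have h2 : (k : ℝ) * (-(α / k)) = -α := by field_simp
    linarith
  have ht : star (Matrix.trace (hermPart GS * Sig)) = Matrix.trace (hermPart GS * Sig) := by
    rw [← trace_conjTranspose, conjTranspose_mul, hS, hH, trace_mul_comm]
  have htim : (Matrix.trace (hermPart GS * Sig)).im = 0 := Complex.conj_eq_iff_im.1 ht
  refine ⟨⟨?_, ?_⟩, ?_⟩
  · have h1 : Uᴴ * gradU = Uᴴ * GU - GUᴴ * U := by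
      rw [hgU, Matrix.mul_sub, Matrix.mul_assoc U, ← Matrix.mul_assoc Uᴴ U, hU, Matrix.one_mul]
    rw [h1]
    simp [conjTranspose_sub, conjTranspose_mul]
  · rw [hgS, Matrix.IsHermitian, conjTranspose_sub, conjTranspose_smul, conjTranspose_smul,
      conjTranspose_smul, conjTranspose_mul, conjTranspose_mul, hS, hH, ht, Matrix.mul_assoc]
    simp
  · intro ξU ξS hξU hξS
    have hξ : ξSᴴ = ξS := hξS
    have hUpart : (Matrix.trace (gradUᴴ * ((1 : Matrix (Fin p) (Fin p) ℂ)
        - (1/2 : ℂ) • (U * Uᴴ)) * ξU)).re = (Matrix.trace (GUᴴ * ξU)).re := by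
      have h1 : gradUᴴ * ((1 : Matrix (Fin p) (Fin p) ℂ) - (1/2 : ℂ) • (U * Uᴴ)) * ξU
          = GUᴴ * ξU - (1/2 : ℂ) • ((GUᴴ * U + Uᴴ * GU) * (Uᴴ * ξU)) := by
        have h0 : gradUᴴ * U = GUᴴ * U - Uᴴ * GU := by
          rw [hgU]
          simp only [conjTranspose_sub, conjTranspose_mul, conjTranspose_conjTranspose,
            Matrix.sub_mul, Matrix.mul_assoc, hU, Matrix.mul_one]
        have h00 : gradUᴴ = GUᴴ - Uᴴ * GU * Uᴴ := by
          rw [hgU]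
          simp only [conjTranspose_sub, conjTranspose_mul, conjTranspose_conjTranspose,
            Matrix.mul_assoc]
        rw [Matrix.mul_sub, Matrix.mul_one, Matrix.mul_smul, ← Matrix.mul_assoc, h0, h00]
        simp only [Matrix.sub_mul, Matrix.add_mul, Matrix.smul_mul, Matrix.mul_assoc]
        module
      have h2 : star (Matrix.trace ((GUᴴ * U + Uᴴ * GU) * (Uᴴ * ξU)))
          = - Matrix.trace ((GUᴴ * U + Uᴴ * GU) * (Uᴴ * ξU)) := by
        rw [← trace_conjTranspose, conjTranspose_mul, hξU, trace_mul_comm, Matrix.mul_neg,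
          trace_neg]
        simp only [conjTranspose_add, conjTranspose_mul, conjTranspose_conjTranspose]
        rw [add_comm]
      have h3 : (Matrix.trace ((GUᴴ * U + Uᴴ * GU) * (Uᴴ * ξU))).re = 0 := by
        have := congrArg Complex.re h2
        simp only [Complex.star_def, Complex.conj_re, Complex.neg_re] at this
        linarith
      rw [h1, trace_sub, trace_smul, smul_eq_mul, Complex.sub_re, Complex.mul_re, h3]
      norm_num
    have hHξ : (Matrix.trace (hermPart GS * ξS)).re = (Matrix.trace (GSᴴ * ξS)).re := by
      have h1 : star (Matrix.trace (GS * ξS)) = Matrix.trace (GSᴴ * ξS) := by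
        rw [← trace_conjTranspose, conjTranspose_mul, hξ, trace_mul_comm]
      have h2 := congrArg Complex.re h1
      simp only [Complex.star_def, Complex.conj_re] at h2
      rw [hermPart, Matrix.smul_mul, Matrix.add_mul, trace_smul, trace_add, smul_eq_mul,
        Complex.mul_re, Complex.add_re, h2]
      norm_num
      ring
    have hA : Sig⁻¹ * gradS = (α⁻¹ : ℝ) • (hermPart GS * Sig)
        - (β / (α * (α + k * β)) : ℝ) • (Matrix.trace (hermPart GS * Sig) • 1) := by
      rw [hgS, Matrix.mul_sub, Matrix.mul_smul, Matrix.mul_smul, Matrix.mul_smul, hl,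
        Matrix.mul_assoc Sig, ← Matrix.mul_assoc Sig⁻¹, hl, Matrix.one_mul]
    have hB : Sig⁻¹ * gradS * Sig⁻¹ * ξS = (α⁻¹ : ℝ) • (hermPart GS * ξS)
        - (β / (α * (α + k * β)) : ℝ) • (Matrix.trace (hermPart GS * Sig) • (Sig⁻¹ * ξS)) := by
      rw [hA]
      simp only [Matrix.sub_mul, Matrix.smul_mul, Matrix.one_mul]
      rw [Matrix.mul_assoc (hermPart GS), hr, Matrix.mul_one]
    rw [hUpart, hB, hA, ← hHξ]
    simp only [trace_sub, trace_smul, trace_one, Complex.sub_re, Complex.smul_re, smul_eq_mul,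
      Complex.mul_re, htim, Fintype.card_fin, Complex.natCast_re, zero_mul, sub_zero]
    have hd := hpos.ne'
    have hα0 := hα.ne'
    generalize (hermPart GS * Sig).trace.re = t
    generalize (Sig⁻¹ * ξS).trace.re = s
    generalize (hermPart GS * ξS).trace.re = x
    generalize (GUᴴ * ξU).trace.re = y
    obtain ⟨d, hdd⟩ : ∃ d, d = α + k * β := ⟨_, rfl⟩
    rw [← hdd] at hd ⊢
    field_simp
    rw [hdd]
    ring
end

section
/- Let p > k ≥ 1, let U ∈ ℂ^{p×k} and U_⊥ ∈ ℂ^{p×(p−k)} satisfy U^H U = I_k and U^H U_⊥ = 0, let Σ be a k×k Hermitian positive definite complex matrix, and let K ∈ ℂ^{(p−k)×k}. Set R = I_p + U Σ U^H, D = U Σ K^H U_⊥^H + U_⊥ K Σ U^H, and Ξ = (I_k + Σ^{-1})^{-1}. Then: (i) tr(R^{-1} D) = 0; (ii) R^{-1} D R^{-1} = U_⊥ K Σ (I_k − Ξ) U^H + U (I_k − Ξ) Σ K^H U_⊥^H. -/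
open Matrix
open scoped ComplexOrder

/-- For the spiked covariance `R = I_p + UΣUᴴ` and the tangent direction
`D = UΣKᴴU⊥ᴴ + U⊥KΣUᴴ` (with `U⊥` an orthonormal complement of `U`), one has
`tr(R⁻¹ D) = 0` and `R⁻¹ D R⁻¹ = U⊥ K Σ (I − Ξ) Uᴴ + U (I − Ξ) Σ Kᴴ U⊥ᴴ`, where
`Ξ = (I + Σ⁻¹)⁻¹`.  Here `Sig` plays the role of `Σ` and `Up` that of `U_⊥`. -/
theorem spiked_fim_offdiag_computation (p k : ℕ) (hk : 1 ≤ k) (hpk : k < p)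
    (U : Matrix (Fin p) (Fin k) ℂ) (Up : Matrix (Fin p) (Fin (p - k)) ℂ)
    (hU : Uᴴ * U = 1) (hUUp : Uᴴ * Up = 0)
    (Sig : Matrix (Fin k) (Fin k) ℂ) (hSig : Sig.PosDef)
    (K : Matrix (Fin (p - k)) (Fin k) ℂ) :
    ∀ (R : Matrix (Fin p) (Fin p) ℂ) (D : Matrix (Fin p) (Fin p) ℂ)
      (Xi : Matrix (Fin k) (Fin k) ℂ),
      R = 1 + U * Sig * Uᴴ →
      D = U * Sig * Kᴴ * Upᴴ + Up * K * Sig * Uᴴ →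
      Xi = (1 + Sig⁻¹)⁻¹ →
      Matrix.trace (R⁻¹ * D) = 0
      ∧ R⁻¹ * D * R⁻¹
          = Up * K * Sig * (1 - Xi) * Uᴴ + U * (1 - Xi) * Sig * Kᴴ * Upᴴ := by
  intro R D Xi hR hD hXi
  have hS : IsUnit Sig.det := (Matrix.isUnit_iff_isUnit_det _).1 hSig.isUnit
  have hP : (1 + Sig⁻¹).PosDef := Matrix.PosDef.one.add hSig.inv
  have hPu : IsUnit (1 + Sig⁻¹).det := (Matrix.isUnit_iff_isUnit_det _).1 hP.isUnit
  have h1 : (1 + Sig⁻¹) * Xi = 1 := by rw [hXi]; exact Matrix.mul_nonsing_inv _ hPu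
  have h2 : Sig * Xi + Xi = Sig := by
    have h := congrArg (fun M => Sig * M) h1
    simp only [← Matrix.mul_assoc, Matrix.mul_add, Matrix.mul_one,
      Matrix.mul_nonsing_inv _ hS] at h
    rw [Matrix.add_mul, Matrix.one_mul] at h
    exact h
  have hUpU : Upᴴ * U = 0 := by
    have h := congrArg Matrix.conjTranspose hUUp
    simpa using h
  have hW : R⁻¹ = 1 - U * Xi * Uᴴ := by
    apply Matrix.inv_eq_right_inv
    have e : U * Sig * Uᴴ * (U * Xi * Uᴴ) = U * (Sig * Xi) * Uᴴ := by
      calc _ = U * Sig * (Uᴴ * U) * Xi * Uᴴ := by simp only [Matrix.mul_assoc]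
        _ = _ := by rw [hU]; simp only [Matrix.mul_assoc, Matrix.one_mul]
    have e2 : U * Sig * Uᴴ = U * (Sig * Xi) * Uᴴ + U * Xi * Uᴴ := by
      rw [← Matrix.add_mul, ← Matrix.mul_add, h2]
    rw [hR, Matrix.add_mul, Matrix.mul_sub, Matrix.mul_sub, e, Matrix.one_mul, Matrix.one_mul,
      Matrix.mul_one, e2]
    abel
  have a1 : R⁻¹ * U = U * (1 - Xi) := by
    rw [hW, Matrix.sub_mul, Matrix.mul_assoc _ Uᴴ U, hU, Matrix.mul_sub]; simp
  have a2 : R⁻¹ * Up = Up := by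
    rw [hW, Matrix.sub_mul, Matrix.mul_assoc _ Uᴴ Up, hUUp]; simp
  have a3 : Uᴴ * R⁻¹ = (1 - Xi) * Uᴴ := by
    rw [hW, Matrix.mul_sub, Matrix.mul_assoc U, ← Matrix.mul_assoc Uᴴ U, hU, Matrix.sub_mul]; simp
  have a4 : Upᴴ * R⁻¹ = Upᴴ := by
    rw [hW, Matrix.mul_sub, Matrix.mul_assoc U, ← Matrix.mul_assoc Upᴴ U, hUpU]; simp
  have hWD : R⁻¹ * D = U * (1 - Xi) * Sig * Kᴴ * Upᴴ + Up * K * Sig * Uᴴ := by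
    rw [hD, Matrix.mul_add]
    simp only [← Matrix.mul_assoc]
    rw [a1, a2]
  constructor
  · rw [hWD, Matrix.trace_add, Matrix.trace_mul_comm _ Upᴴ, Matrix.trace_mul_comm _ Uᴴ]
    simp only [← Matrix.mul_assoc]
    rw [hUpU, hUUp]
    simp
  · rw [hWD, Matrix.add_mul, Matrix.mul_assoc _ Upᴴ, a4, Matrix.mul_assoc _ Uᴴ, a3,
      ← Matrix.mul_assoc, add_comm]
end

section
/- Let p > k ≥ 1, let U ∈ ℂ^{p×k} and U_⊥ ∈ ℂ^{p×(p−k)} satisfy U^H U = I_k and U^H U_⊥ = 0, let Σ be a k×k Hermitian positive definite complex matrix, let K ∈ ℂ^{(p−k)×k}, let Ω ∈ ℂ^{k×k} be skew-Hermitian, let ξ_Σ ∈ ℂ^{k×k} be Hermitian, and let a, b ∈ ℝ. Set R = I_p + U Σ U^H and define, for p×p matrices X, Y, the pairing g(X,Y) = a·Re tr(R^{-1} X R^{-1} Y) + b·Re(tr(R^{-1} X)·tr(R^{-1} Y)). Let D_⊥ = U Σ K^H U_⊥^H + U_⊥ K Σ U^H, D_U = U Σ Ω^H U^H + U Ω Σ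 U^H, and D_Σ = U ξ_Σ U^H. Then g(D_⊥, D_U) = 0 and g(D_⊥, D_Σ) = 0. Consequently the Fisher information matrix of the spiked elliptical model is block-diagonal, with the block corresponding to directions U_⊥ K decoupled from the blocks corresponding to directions (UΩ, ·) and (0, ξ_Σ). -/
open Matrix
open scoped ComplexOrder

theorem aux_tr {p k m : ℕ} (U : Matrix (Fin p) (Fin k) ℂ) (Up : Matrix (Fin p) (Fin m) ℂ)
    (V : Matrix (Fin p) (Fin p) ℂ)
    (h1 : Upᴴ * V * U = 0) (h2 : Uᴴ * V * Up = 0)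
    (A : Matrix (Fin k) (Fin m) ℂ) (B : Matrix (Fin m) (Fin k) ℂ)
    (C : Matrix (Fin k) (Fin k) ℂ) :
    Matrix.trace (V * (U * A * Upᴴ + Up * B * Uᴴ)) = 0 ∧
    Matrix.trace (V * (U * A * Upᴴ + Up * B * Uᴴ) * V * (U * C * Uᴴ)) = 0 := by
  have e1 : V * (U * A * Upᴴ + Up * B * Uᴴ) = (V * U * A) * Upᴴ + (V * Up * B) * Uᴴ := by
    simp only [Matrix.mul_add, Matrix.mul_assoc]
  constructor
  · rw [e1, Matrix.trace_add, Matrix.trace_mul_comm, Matrix.trace_mul_comm (V * Up * B)]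
    simp only [← Matrix.mul_assoc, h1, h2]
    simp
  · have e2 : V * (U * A * Upᴴ + Up * B * Uᴴ) * V * (U * C * Uᴴ)
        = V * U * A * (Upᴴ * V * U) * C * Uᴴ + (V * Up * B * Uᴴ * V * U * C) * Uᴴ := by
      simp only [Matrix.mul_add, Matrix.add_mul, Matrix.mul_assoc]
    rw [e2, h1, Matrix.trace_add, Matrix.trace_mul_comm (V * Up * B * Uᴴ * V * U * C)]
    simp only [← Matrix.mul_assoc, h2]
    simp

/-- Block-diagonality of the Fisher information of the spiked elliptical
model: with `R = I_p + UΣUᴴ` and the Fisher-type pairing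
`g(X,Y) = a·Re tr(R⁻¹XR⁻¹Y) + b·Re(tr(R⁻¹X)·tr(R⁻¹Y))`, the direction
`D⊥ = UΣKᴴU⊥ᴴ + U⊥KΣUᴴ` is `g`-orthogonal to both `D_U = UΣΩᴴUᴴ + UΩΣUᴴ` (`Ω`
skew-Hermitian) and `D_Σ = UξΣUᴴ` (`ξΣ` Hermitian).
Here `Sig` plays the role of `Σ` and `Up` that of `U_⊥`. -/
theorem spiked_fim_block_diagonal (p k : ℕ) (hk : 1 ≤ k) (hpk : k < p)
    (U : Matrix (Fin p) (Fin k) ℂ) (Up : Matrix (Fin p) (Fin (p - k)) ℂ)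
    (hU : Uᴴ * U = 1) (hUUp : Uᴴ * Up = 0)
    (Sig : Matrix (Fin k) (Fin k) ℂ) (hSig : Sig.PosDef)
    (K : Matrix (Fin (p - k)) (Fin k) ℂ)
    (Ω : Matrix (Fin k) (Fin k) ℂ) (hΩ : Ωᴴ = -Ω)
    (ξS : Matrix (Fin k) (Fin k) ℂ) (hξS : ξS.IsHermitian)
    (a b : ℝ) :
    ∀ (R Dperp DU DS : Matrix (Fin p) (Fin p) ℂ),
      R = 1 + U * Sig * Uᴴ →
      Dperp = U * Sig * Kᴴ * Upᴴ + Up * K * Sig * Uᴴ →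
      DU = U * Sig * Ωᴴ * Uᴴ + U * Ω * Sig * Uᴴ →
      DS = U * ξS * Uᴴ →
      (a * (Matrix.trace (R⁻¹ * Dperp * R⁻¹ * DU)).re
          + b * (Matrix.trace (R⁻¹ * Dperp) * Matrix.trace (R⁻¹ * DU)).re = 0)
      ∧ (a * (Matrix.trace (R⁻¹ * Dperp * R⁻¹ * DS)).re
          + b * (Matrix.trace (R⁻¹ * Dperp) * Matrix.trace (R⁻¹ * DS)).re = 0) := by
  intro R Dperp DU DS hR hD hDU hDS
  have hUpU : Upᴴ * U = 0 := by
    have := congrArg Matrix.conjTranspose hUUp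
    simpa [Matrix.conjTranspose_mul] using this
  have key : Upᴴ * R⁻¹ * U = 0 ∧ Uᴴ * R⁻¹ * Up = 0 := by
    by_cases hdet : IsUnit R.det
    · have r1 : R * Up = Up := by
        rw [hR, Matrix.add_mul, Matrix.mul_assoc, hUUp]; simp
      have r2 : Upᴴ * R = Upᴴ := by
        rw [hR, Matrix.mul_add, ← Matrix.mul_assoc, ← Matrix.mul_assoc, hUpU]; simp
      have i1 : R⁻¹ * Up = Up := by
        conv_lhs => rw [← r1]
        rw [Matrix.nonsing_inv_mul_cancel_left _ _ hdet]
      have i2 : Upᴴ * R⁻¹ = Upᴴ := by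
        conv_lhs => rw [← r2]
        rw [Matrix.mul_nonsing_inv_cancel_right _ _ hdet]
      exact ⟨by rw [i2, hUpU], by rw [Matrix.mul_assoc, i1, hUUp]⟩
    · rw [Matrix.nonsing_inv_apply_not_isUnit _ hdet]; simp
  have hD2 : Dperp = U * (Sig * Kᴴ) * Upᴴ + Up * (K * Sig) * Uᴴ := by
    rw [hD]; simp only [Matrix.mul_assoc]
  have hDU2 : DU = U * (Sig * Ωᴴ + Ω * Sig) * Uᴴ := by
    rw [hDU]; simp only [Matrix.mul_assoc, Matrix.mul_add, Matrix.add_mul]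
  have t := aux_tr U Up R⁻¹ key.1 key.2 (Sig * Kᴴ) (K * Sig)
  rw [← hD2] at t
  have tU := t (Sig * Ωᴴ + Ω * Sig)
  have tS := t ξS
  rw [← hDU2] at tU
  rw [← hDS] at tS
  rw [tU.1, tU.2, tS.2]
  simp
end

section
/- Let k ≥ 1, let Σ be a k×k Hermitian positive definite complex matrix with positive definite square root Σ^{1/2}, and let α, β be real with α > 0 and α + kβ > 0. For a Hermitian matrix H ∈ ℂ^{k×k} define e(H) = (1/√α) Σ^{1/2} H Σ^{1/2} + ((√α − √(α+kβ))/(k√α·√(α+kβ))) · tr(H) · Σ. Then e(H) is Hermitian, and for all Hermitian H, H' ∈ ℂ^{k×k}: α · Re tr(Σ^{-1} e(H) Σ^{-1} e(H')) + β · Re tr(Σ^{-1} e(H)) · Re tr(Σ^{-1} e(H')) = Re tr(H H'). That is, e is a linear isometry from the space of Hermitian matrices with the (real) Frobenius inner product onto the tangent space of H^{++}_k at Σ endowed with the metric α tr(Σ^{-1}·Σ^{-1}·) + β tr(Σ^{-1}·)tr(Σ^{-1}·); in particular the images of an orthonormal Frobenius basis of Hermitian matrices form an orthonormal basis for this metric.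 -/
open Matrix
open scoped ComplexOrder

/-- The map
`e(H) = (1/√α) Σ^{1/2} H Σ^{1/2} + ((√α − √(α+kβ))/(k√α√(α+kβ))) tr(H) Σ`
sends Hermitian matrices to Hermitian matrices and is an isometry from the Frobenius inner
product onto the tangent space of `H^{++}_k` at `Σ` with the metric
`α tr(Σ⁻¹·Σ⁻¹·) + β tr(Σ⁻¹·)tr(Σ⁻¹·)`.
Here `Sig` plays the role of `Σ` and `S` that of `Σ^{1/2}`. -/
theorem sigma_orthonormal_basis_isometry (k : ℕ) (hk : 1 ≤ k)
    (Sig : Matrix (Fin k) (Fin k) ℂ) (hSig : Sig.PosDef)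
    (S : Matrix (Fin k) (Fin k) ℂ) (hS : S.PosDef) (hS2 : S * S = Sig)
    (α β : ℝ) (hα : 0 < α) (hαβ : 0 < α + k * β) :
    ∀ e : Matrix (Fin k) (Fin k) ℂ → Matrix (Fin k) (Fin k) ℂ,
      (e = fun H => ((Real.sqrt α)⁻¹ : ℝ) • (S * H * S)
        + ((Real.sqrt α - Real.sqrt (α + k * β))
            / (k * Real.sqrt α * Real.sqrt (α + k * β)) : ℝ)
          • (Matrix.trace H • Sig)) →
      (∀ H : Matrix (Fin k) (Fin k) ℂ, H.IsHermitian → (e H).IsHermitian)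
      ∧ (∀ H H' : Matrix (Fin k) (Fin k) ℂ, H.IsHermitian → H'.IsHermitian →
          α * (Matrix.trace (Sig⁻¹ * e H * Sig⁻¹ * e H')).re
            + β * ((Matrix.trace (Sig⁻¹ * e H)).re * (Matrix.trace (Sig⁻¹ * e H')).re)
          = (Matrix.trace (H * H')).re) := by
  intro e he
  have hkpos : (0 : ℝ) < k := by exact_mod_cast hk
  have hdet : IsUnit S.det := (Matrix.isUnit_iff_isUnit_det S).1 hS.isUnit
  have hl : S⁻¹ * S = 1 := Matrix.nonsing_inv_mul S hdet
  have hr : S * S⁻¹ = 1 := Matrix.mul_nonsing_inv S hdet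
  have hinv : Sig⁻¹ = S⁻¹ * S⁻¹ := by rw [← hS2, Matrix.mul_inv_rev]
  obtain ⟨a, ha⟩ : ∃ a : ℝ, a = (Real.sqrt α)⁻¹ := ⟨_, rfl⟩
  obtain ⟨c, hc⟩ : ∃ c : ℝ, c = (Real.sqrt α - Real.sqrt (α + k * β))
            / (k * Real.sqrt α * Real.sqrt (α + k * β)) := ⟨_, rfl⟩
  rw [← ha, ← hc] at he
  have htr : ∀ H : Matrix (Fin k) (Fin k) ℂ, H.IsHermitian → (Matrix.trace H).im = 0 := by
    intro H hH
    have h : star (Matrix.trace H) = Matrix.trace H := by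
      rw [← Matrix.trace_conjTranspose, hH.eq]
    exact Complex.conj_eq_iff_im.1 h
  have heX : ∀ H, e H = S * ((a : ℂ) • H + ((c : ℂ) * Matrix.trace H) • 1) * S := by
    intro H
    rw [he, ← hS2]
    simp only [Matrix.mul_add, Matrix.add_mul, Matrix.mul_smul, Matrix.smul_mul, Matrix.mul_one,
      mul_smul, Complex.coe_smul]
  have hcancel : ∀ X : Matrix (Fin k) (Fin k) ℂ, Sig⁻¹ * (S * X * S) = S⁻¹ * X * S := by
    intro X
    calc Sig⁻¹ * (S * X * S) = S⁻¹ * (S⁻¹ * S) * X * S := by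
          rw [hinv]; simp only [Matrix.mul_assoc]
      _ = _ := by rw [hl, Matrix.mul_one]
  have hconj : ∀ X : Matrix (Fin k) (Fin k) ℂ,
      Matrix.trace (S⁻¹ * X * S) = Matrix.trace X := by
    intro X
    rw [Matrix.trace_mul_comm, ← Matrix.mul_assoc, hr, Matrix.one_mul]
  refine ⟨?_, ?_⟩
  · intro H hH
    have h : star (Matrix.trace H) = Matrix.trace H := by
      rw [← Matrix.trace_conjTranspose, hH.eq]
    rw [heX, Matrix.IsHermitian]
    simp only [Matrix.conjTranspose_mul, Matrix.conjTranspose_add, Matrix.conjTranspose_smul,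
      Matrix.conjTranspose_one, hS.1.eq, hH.eq, star_mul', h, Matrix.mul_assoc]
    simp
  · intro H H' hH hH'
    have h1 := htr H hH
    have h2 := htr H' hH'
    have e1 : ∀ X Y : Matrix (Fin k) (Fin k) ℂ,
        Matrix.trace (Sig⁻¹ * (S * X * S) * Sig⁻¹ * (S * Y * S)) = Matrix.trace (X * Y) := by
      intro X Y
      rw [Matrix.mul_assoc (Sig⁻¹ * (S * X * S)), hcancel, hcancel, ← hconj (X * Y)]
      congr 1
      calc S⁻¹ * X * S * (S⁻¹ * Y * S) = S⁻¹ * X * (S * S⁻¹) * Y * S := by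
            simp only [Matrix.mul_assoc]
        _ = _ := by rw [hr, Matrix.mul_one, Matrix.mul_assoc S⁻¹ X Y]
    rw [heX, heX, e1, hcancel, hcancel, hconj, hconj]
    simp only [Matrix.mul_add, Matrix.add_mul, Matrix.mul_smul, Matrix.smul_mul, Matrix.mul_one,
      Matrix.one_mul, Matrix.trace_add, Matrix.trace_smul, Matrix.trace_one, smul_eq_mul,
      Fintype.card_fin, Complex.add_re, Complex.mul_re, Complex.mul_im, Complex.ofReal_re,
      Complex.ofReal_im, Complex.natCast_re, Complex.natCast_im, h1, h2]
    have hs : 0 < Real.sqrt α := Real.sqrt_pos.2 hα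
    have hg : 0 < Real.sqrt (α + k * β) := Real.sqrt_pos.2 hαβ
    have A : α * a ^ 2 = 1 := by
      rw [ha, inv_pow, Real.sq_sqrt hα.le, mul_inv_cancel₀ hα.ne']
    have B : a + c * k = (Real.sqrt (α + k * β))⁻¹ := by
      rw [ha, hc]; field_simp; ring
    have C : (α + k * β) * (a + c * k) ^ 2 = 1 := by
      rw [B, inv_pow, Real.sq_sqrt hαβ.le, mul_inv_cancel₀ hαβ.ne']
    have D : α * (2 * a * c + c ^ 2 * k) + β * (a + c * k) ^ 2 = 0 := by
      have : (k : ℝ) * (α * (2 * a * c + c ^ 2 * k) + β * (a + c * k) ^ 2) = 0 := by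
        linear_combination C - A
      exact (mul_eq_zero.1 this).resolve_left hkpos.ne'
    linear_combination (Matrix.trace (H * H')).re * A
      + (Matrix.trace H).re * (Matrix.trace H').re * D
end
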